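/- Let S be a local commutative semiring with 1 ≠ 0 and M a multiplication S-semimodule. If N is a weakly 1-absorbing prime subtractive subsemimodule of M that is not 1-absorbing prime, then N³ = 0, where N³ denotes the subsemimodule (N :_S M)³ • M. -/

import Mathlib

open Submodule

/-- The ideal `(N :_S M) = {s : S | s • M ⊆ N}`. -/
def colonSM {S M : Type*} [CommSemiring S] [AddCommMonoid M] [Module S M]
    (N : Submodule S M) : Ideal S where
  carrier := {s : S | ∀ m : M, s • m ∈ N}
  add_mem' := by
    intro a b ha hb m
    rw [add_smul]
    exact N.add_mem (ha m) (hb m)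
  zero_mem' := by
    intro m
    rw [zero_smul]
    exact N.zero_mem
  smul_mem' := by
    intro c s hs m
    rw [smul_eq_mul, mul_smul]
    exact N.smul_mem c (hs m)

/-- A prime subsemimodule: a proper subsemimodule `N` such that `a • m ∈ N` implies
`a ∈ (N :_S M)` or `m ∈ N`. -/
def IsPrimeSubmodule {S M : Type*} [CommSemiring S] [AddCommMonoid M] [Module S M]
    (N : Submodule S M) : Prop :=
  N ≠ ⊤ ∧ ∀ (a : S) (m : M), a • m ∈ N → a ∈ colonSM N ∨ m ∈ N

/-- A `1`-absorbing prime subsemimodule: a proper subsemimodule `N` such that for all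
nonunits `a b : S` and `m : M`, `(a * b) • m ∈ N` implies `a * b ∈ (N :_S M)` or `m ∈ N`. -/
def IsOneAbsorbingPrimeSubmodule {S M : Type*} [CommSemiring S] [AddCommMonoid M] [Module S M]
    (N : Submodule S M) : Prop :=
  N ≠ ⊤ ∧ ∀ a b : S, ¬ IsUnit a → ¬ IsUnit b → ∀ m : M,
    (a * b) • m ∈ N → a * b ∈ colonSM N ∨ m ∈ N

/-- A weakly `1`-absorbing prime subsemimodule: a proper subsemimodule `N` such that for all
nonunits `a b : S` and `m : M`, `0 ≠ (a * b) • m ∈ N` implies `a * b ∈ (N :_S M)` or `m ∈ N`. -/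
def IsWeaklyOneAbsorbingPrimeSubmodule {S M : Type*} [CommSemiring S] [AddCommMonoid M]
    [Module S M] (N : Submodule S M) : Prop :=
  N ≠ ⊤ ∧ ∀ a b : S, ¬ IsUnit a → ¬ IsUnit b → ∀ m : M,
    (a * b) • m ∈ N → (a * b) • m ≠ 0 → a * b ∈ colonSM N ∨ m ∈ N

/-- A `1`-absorbing prime ideal: a proper ideal `I` such that for all nonunits `a b c : S`,
`a * b * c ∈ I` implies `a * b ∈ I` or `c ∈ I`. -/
def IsOneAbsorbingPrimeIdeal {S : Type*} [CommSemiring S] (I : Ideal S) : Prop :=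
  I ≠ ⊤ ∧ ∀ a b c : S, ¬ IsUnit a → ¬ IsUnit b → ¬ IsUnit c →
    a * b * c ∈ I → a * b ∈ I ∨ c ∈ I

/-- A weakly `1`-absorbing prime ideal: a proper ideal `I` such that for all nonunits
`a b c : S`, `0 ≠ a * b * c ∈ I` implies `a * b ∈ I` or `c ∈ I`. -/
def IsWeaklyOneAbsorbingPrimeIdeal {S : Type*} [CommSemiring S] (I : Ideal S) : Prop :=
  I ≠ ⊤ ∧ ∀ a b c : S, ¬ IsUnit a → ¬ IsUnit b → ¬ IsUnit c →
    a * b * c ∈ I → a * b * c ≠ 0 → a * b ∈ I ∨ c ∈ I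

/-- A local semiring: the sum of any two nonunits is a nonunit. -/
def IsLocalSemiring (S : Type*) [CommSemiring S] : Prop :=
  ∀ a b : S, ¬ IsUnit a → ¬ IsUnit b → ¬ IsUnit (a + b)

/-- A subtractive subsemimodule: `x ∈ N` and `x + y ∈ N` imply `y ∈ N`. -/
def Subtractive {S M : Type*} [CommSemiring S] [AddCommMonoid M] [Module S M]
    (N : Submodule S M) : Prop :=
  ∀ x y : M, x ∈ N → x + y ∈ N → y ∈ N

/-- A strong subsemimodule: every element of `N` has an additive inverse in `N`. -/
def StrongSubmodule {S M : Type*} [CommSemiring S] [AddCommMonoid M] [Module S M]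
    (N : Submodule S M) : Prop :=
  ∀ x ∈ N, ∃ y ∈ N, x + y = 0

/-- A multiplication semimodule: every subsemimodule has the form `I • M` for an ideal `I`. -/
def IsMultiplicationSemimodule (S M : Type*) [CommSemiring S] [AddCommMonoid M]
    [Module S M] : Prop :=
  ∀ N : Submodule S M, ∃ I : Ideal S, N = I • (⊤ : Submodule S M)

/-- A multiplicatively cancellative (MC) semimodule: `s • x = t • x` with `x ≠ 0`
implies `s = t`. -/
def IsMC (S M : Type*) [CommSemiring S] [AddCommMonoid M] [Module S M] : Prop :=
  ∀ (s t : S) (x : M), x ≠ 0 → s • x = t • x → s = t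

/-- Elements of `(N :_S M)` are nonunits when `N` is proper. -/
theorem not_isUnit_of_mem_colonSM {S M : Type*} [CommSemiring S] [AddCommMonoid M] [Module S M]
    {N : Submodule S M} (hN : N ≠ ⊤) {p : S} (hp : p ∈ colonSM N) : ¬ IsUnit p := by
  rintro ⟨u, rfl⟩
  refine hN (eq_top_iff.2 fun x _ => ?_)
  have h : (u : S) • ((↑u⁻¹ : S) • x) ∈ N := hp _
  rwa [smul_smul, Units.mul_inv, one_smul] at h

/-- If `(a, b, m)` witnesses that a weakly `1`-absorbing prime subtractive subsemimodule `N` is not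
`1`-absorbing prime, then so does every translate of it by `(N :_S M)`, `(N :_S M)` and `N`; in
particular the corresponding product vanishes. -/
theorem IsWeaklyOneAbsorbingPrimeSubmodule.add_mul_add_smul_add_eq_zero
    {S M : Type*} [CommSemiring S] [AddCommMonoid M] [Module S M]
    (hloc : IsLocalSemiring S) {N : Submodule S M}
    (hw : IsWeaklyOneAbsorbingPrimeSubmodule N) (hsub : Subtractive N)
    {a b : S} (ha : ¬ IsUnit a) (hb : ¬ IsUnit b) {m : M} (habm : (a * b) • m ∈ N)
    (hab : a * b ∉ colonSM N) (hm : m ∉ N)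
    {p q : S} (hp : p ∈ colonSM N) (hq : q ∈ colonSM N) {n : M} (hn : n ∈ N) :
    ((a + p) * (b + q)) • (m + n) = 0 := by
  have hr : a * q + p * (b + q) ∈ colonSM N :=
    add_mem (Ideal.mul_mem_left _ _ hq) (Ideal.mul_mem_right _ _ hp)
  have hexp : (a + p) * (b + q) = a * q + p * (b + q) + a * b := by ring
  by_contra h0
  have hmem : ((a + p) * (b + q)) • (m + n) ∈ N := by
    rw [smul_add]
    refine N.add_mem ?_ (N.smul_mem _ hn)
    rw [hexp, add_smul]
    exact N.add_mem (hr m) habm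
  rcases hw.2 _ _ (hloc a p ha (not_isUnit_of_mem_colonSM hw.1 hp))
    (hloc b q hb (not_isUnit_of_mem_colonSM hw.1 hq)) _ hmem h0 with h | h
  · refine hab fun x => hsub _ _ (hr x) ?_
    rw [← add_smul, ← hexp]
    exact h x
  · exact hm (hsub n m hn (by rwa [add_comm]))

/-- Let `S` be a local semiring and `M` a multiplication semimodule. If `N` is a weakly
`1`-absorbing prime subtractive subsemimodule of `M` that is not `1`-absorbing prime, then
`N³ = (N :_S M)³ • M = 0`. -/
theorem cube_eq_bot_of_weakly_not_oneAbsorbingPrime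
    {S M : Type*} [CommSemiring S] [Nontrivial S] [AddCommMonoid M] [Module S M]
    (hloc : IsLocalSemiring S) (hMul : IsMultiplicationSemimodule S M)
    (N : Submodule S M)
    (hw : IsWeaklyOneAbsorbingPrimeSubmodule N) (hsub : Subtractive N)
    (hnot : ¬ IsOneAbsorbingPrimeSubmodule N) :
    (colonSM N ^ 3) • (⊤ : Submodule S M) = ⊥ := by
  obtain ⟨a, b, ha, hb, m, habm, hab, hm⟩ : ∃ a b : S, ¬ IsUnit a ∧ ¬ IsUnit b ∧ ∃ m : M,
      (a * b) • m ∈ N ∧ a * b ∉ colonSM N ∧ m ∉ N := by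
    by_contra! h
    exact hnot ⟨hw.1, fun a b ha hb m habm => or_iff_not_imp_left.2 (h a b ha hb m habm)⟩
  have key {p q : S} (hp : p ∈ colonSM N) (hq : q ∈ colonSM N) {n : M} (hn : n ∈ N) :
      ((a + p) * (b + q)) • (m + n) = 0 :=
    hw.add_mul_add_smul_add_eq_zero hloc hsub ha hb habm hab hm hp hq hn
  have zS : (0 : S) ∈ colonSM N := zero_mem _
  have zM : (0 : M) ∈ N := zero_mem _
  have abm : (a * b) • m = 0 := by simpa using key zS zS zM
  have abn {n : M} (hn : n ∈ N) : (a * b) • n = 0 := by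
    simpa [smul_add, abm] using key zS zS hn
  have aqm {q : S} (hq : q ∈ colonSM N) : (a * q) • m = 0 := by
    simpa [mul_add, add_smul, abm] using key zS hq zM
  have pbm {p : S} (hp : p ∈ colonSM N) : (p * b) • m = 0 := by
    simpa [add_mul, add_smul, abm] using key hp zS zM
  have aqn {q : S} (hq : q ∈ colonSM N) {n : M} (hn : n ∈ N) : (a * q) • n = 0 := by
    simpa [mul_add, add_smul, smul_add, abm, abn hn, aqm hq] using key zS hq hn
  have pbn {p : S} (hp : p ∈ colonSM N) {n : M} (hn : n ∈ N) : (p * b) • n = 0 := by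
    simpa [add_mul, add_smul, smul_add, abm, abn hn, pbm hp] using key hp zS hn
  have pqm {p q : S} (hp : p ∈ colonSM N) (hq : q ∈ colonSM N) : (p * q) • m = 0 := by
    simpa [mul_add, add_mul, add_smul, abm, aqm hq, pbm hp] using key hp hq zM
  have pqn {p q : S} (hp : p ∈ colonSM N) (hq : q ∈ colonSM N) {n : M} (hn : n ∈ N) :
      (p * q) • n = 0 := by
    simpa [mul_add, add_mul, add_smul, smul_add, abm, abn hn, aqm hq, pbm hp, aqn hq hn,
      pbn hp hn, pqm hp hq] using key hp hq hn
  have hN : colonSM N • (⊤ : Submodule S M) ≤ N := Submodule.smul_le.2 fun r hr x _ => hr x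
  rw [pow_succ, Submodule.mul_smul, pow_two, Submodule.mul_smul, eq_bot_iff]
  refine (smul_mono_right _ (smul_mono_right _ hN)).trans ?_
  rw [← Submodule.mul_smul, Submodule.smul_le]
  intro r hr n hn
  rw [Submodule.mem_bot]
  induction hr using Submodule.mul_induction_on' with
  | mem_mul_mem p hp q hq => exact pqn hp hq hn
  | add x _ y _ hx hy => rw [add_smul, hx, hy, add_zero]
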